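/- Let a, b, c, d be integers with a < b and c < d, and let f be a continuously differentiable real-valued function on [a,b] × [c,d] that admits a continuous second order mixed partial derivative ∂²f/∂x∂y there. Then ∑_{a < m ≤ b} ∑_{c < n ≤ d} f(m,n) = ∫_a^b ∫_c^d f(x,y) dx dy + ∫_a^b ∫_c^d (∂f/∂x)(x,y) (x − ⌊x⌋) dx dy + ∫_a^b ∫_c^d (∂f/∂y)(x,y) (y − ⌊y⌋) dx dy + ∫_a^b ∫_c^d (∂²f/∂x∂y)(x,y) (x − ⌊x⌋)(y − ⌊y⌋) dx dy, where the sums run over integers m with a < m ≤ b and integers n with c < n ≤ d, and ⌊t⌋ denotes the largest integer not greater than t. -/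

import Mathlib

open intervalIntegral

theorem aux_fract_int (u v : ℝ) :
    IntervalIntegrable (fun x : ℝ => x - (⌊x⌋ : ℝ)) MeasureTheory.volume u v := by
  have h : (fun x : ℝ => x - (⌊x⌋ : ℝ)) = fun x => Int.fract x := by
    funext x; rfl
  rw [h]
  refine (intervalIntegrable_const (c := (1:ℝ))).mono_fun
    measurable_fract.aestronglyMeasurable ?_
  refine Filter.Eventually.of_forall fun x => ?_
  simp only [Real.norm_eq_abs, abs_one]
  rw [abs_of_nonneg (Int.fract_nonneg x)]
  exact (Int.fract_lt_one x).le

theorem aux_step (k : ℤ) (g g' : ℝ → ℝ)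
    (hg : ∀ x ∈ Set.Icc (k:ℝ) (k+1), HasDerivAt g (g' x) x)
    (hc : ContinuousOn g' (Set.Icc (k:ℝ) (k+1))) :
    g (k+1) = (∫ x in (k:ℝ)..(k+1), g x) + ∫ x in (k:ℝ)..(k+1), g' x * (x - ⌊x⌋) := by
  have hle : (k:ℝ) ≤ k + 1 := by linarith
  have h1 : ∫ x in (k:ℝ)..(k+1), g' x * (x - ⌊x⌋) = ∫ x in (k:ℝ)..(k+1), g' x * (x - k) := by
    apply intervalIntegral.integral_congr_ae
    have : ∀ᵐ x : ℝ, x ≠ k + 1 := by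
      simp [MeasureTheory.ae_iff]
    filter_upwards [this] with x hx hx2
    rw [Set.uIoc_of_le hle] at hx2
    have : ⌊x⌋ = k := by
      rw [Int.floor_eq_iff]
      exact ⟨hx2.1.le, lt_of_le_of_ne hx2.2 hx⟩
    rw [this]
  have h2 := intervalIntegral.integral_deriv_mul_eq_sub (a := (k:ℝ)) (b := k+1)
    (u := g) (v := fun x => x - (k:ℝ)) (u' := g') (v' := fun _ => 1)
    (by rw [Set.uIcc_of_le hle]; exact hg)
    (by intro x _; exact (hasDerivAt_id x).sub_const _)
    (by apply ContinuousOn.intervalIntegrable; rwa [Set.uIcc_of_le hle])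
    (by simp)
  have hgc : ContinuousOn g (Set.uIcc (k:ℝ) (k+1)) := by
    rw [Set.uIcc_of_le hle]; exact fun x hx => (hg x hx).continuousAt.continuousWithinAt
  rw [intervalIntegral.integral_add] at h2
  · simp at h2
    rw [h1]; linarith
  · apply ContinuousOn.intervalIntegrable
    rw [Set.uIcc_of_le hle]; exact hc.mul (by fun_prop)
  · simpa using hgc.intervalIntegrable

theorem aux_int (a b : ℝ) (h : a ≤ b) (g : ℝ → ℝ) (hc : ContinuousOn g (Set.Icc a b)) :
    IntervalIntegrable (fun x => g x * (x - ⌊x⌋)) MeasureTheory.volume a b := by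
  apply IntervalIntegrable.continuousOn_mul (aux_fract_int a b)
  rwa [Set.uIcc_of_le h]

theorem aux_one (a b : ℤ) (hab : a ≤ b) (g g' : ℝ → ℝ)
    (hg : ∀ x ∈ Set.Icc (a:ℝ) b, HasDerivAt g (g' x) x)
    (hc : ContinuousOn g' (Set.Icc (a:ℝ) b)) :
    ∑ m ∈ Finset.Ioc a b, g m =
      (∫ x in (a:ℝ)..b, g x) + ∫ x in (a:ℝ)..b, g' x * (x - ⌊x⌋) := by
  induction b, hab using Int.le_induction with
  | base => simp
  | succ k hk ih =>
    have hk' : (a:ℝ) ≤ k := by exact_mod_cast hk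
    have hle : (k:ℝ) ≤ k + 1 := by linarith
    push_cast at hg hc ⊢
    have s1 : Set.Icc (a:ℝ) k ⊆ Set.Icc (a:ℝ) (k+1) := Set.Icc_subset_Icc_right hle
    have s2 : Set.Icc (k:ℝ) (k+1) ⊆ Set.Icc (a:ℝ) (k+1) := Set.Icc_subset_Icc_left hk'
    have hgc : ContinuousOn g (Set.Icc (a:ℝ) (k+1)) :=
      fun x hx => (hg x hx).continuousAt.continuousWithinAt
    have e : Finset.Ioc a (k+1) = insert (k+1) (Finset.Ioc a k) := by
      ext x; simp only [Finset.mem_Ioc, Finset.mem_insert]; omega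
    rw [e, Finset.sum_insert (by simp), ih (fun x hx => hg x (s1 hx)) (hc.mono s1)]
    push_cast
    rw [aux_step k g g' (fun x hx => hg x (s2 hx)) (hc.mono s2)]
    rw [← intervalIntegral.integral_add_adjacent_intervals (a := (a:ℝ)) (b := k) (c := k+1)
      (f := g), ← intervalIntegral.integral_add_adjacent_intervals (a := (a:ℝ)) (b := k)
      (c := k+1) (f := fun x => g' x * (x - ⌊x⌋))]
    · ring
    · exact aux_int _ _ hk' _ (hc.mono s1)
    · exact aux_int _ _ hle _ (hc.mono s2)
    · apply ContinuousOn.intervalIntegrable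
      rw [Set.uIcc_of_le hk']; exact hgc.mono s1
    · apply ContinuousOn.intervalIntegrable
      rw [Set.uIcc_of_le hle]; exact hgc.mono s2

theorem aux_param (a b c d : ℝ) (hab : a ≤ b) (hcd : c ≤ d) (f : ℝ → ℝ → ℝ)
    (h : ContinuousOn (fun p : ℝ × ℝ => f p.1 p.2) (Set.Icc a b ×ˢ Set.Icc c d)) :
    ContinuousOn (fun x => ∫ y in c..d, f x y) (Set.Icc a b) := by
  have hF : Continuous (Function.uncurry fun x y : ℝ =>
      f (Set.projIcc a b hab x) (Set.projIcc c d hcd y)) := by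
    refine h.comp_continuous (f := fun p : ℝ × ℝ =>
      ((Set.projIcc a b hab p.1 : ℝ), (Set.projIcc c d hcd p.2 : ℝ))) ?_ ?_
    · exact (continuous_subtype_val.comp (continuous_projIcc.comp continuous_fst)).prodMk
        (continuous_subtype_val.comp (continuous_projIcc.comp continuous_snd))
    · intro p
      exact ⟨Subtype.coe_prop _, Subtype.coe_prop _⟩
  have := intervalIntegral.continuous_parametric_intervalIntegral_of_continuous'
    (μ := MeasureTheory.volume) hF c d
  refine this.continuousOn.congr fun x hx => ?_
  apply intervalIntegral.integral_congr
  intro y hy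
  rw [Set.uIcc_of_le hcd] at hy
  simp [Set.projIcc_of_mem hab hx, Set.projIcc_of_mem hcd hy]

/-- Corollary 1 of the paper: a two-dimensional Euler–Maclaurin type formula relating
double sums over lattice points to double integrals. Here `fx = ∂f/∂x`, `fy = ∂f/∂y`
and `fxy = ∂²f/∂x∂y`, and `⌊t⌋` is the floor function. -/
theorem double_sum_eq_double_integrals
    (a b c d : ℤ) (hab : a < b) (hcd : c < d)
    (f fx fy fxy : ℝ → ℝ → ℝ)
    (hfx : ∀ x ∈ Set.Icc (a:ℝ) b, ∀ y ∈ Set.Icc (c:ℝ) d,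
      HasDerivAt (fun x' => f x' y) (fx x y) x)
    (hfy : ∀ x ∈ Set.Icc (a:ℝ) b, ∀ y ∈ Set.Icc (c:ℝ) d,
      HasDerivAt (fun y' => f x y') (fy x y) y)
    (hfxy : ∀ x ∈ Set.Icc (a:ℝ) b, ∀ y ∈ Set.Icc (c:ℝ) d,
      HasDerivAt (fun y' => fx x y') (fxy x y) y)
    (hf_cont : ContinuousOn (fun p : ℝ × ℝ => f p.1 p.2) (Set.Icc (a:ℝ) b ×ˢ Set.Icc (c:ℝ) d))
    (hfx_cont : ContinuousOn (fun p : ℝ × ℝ => fx p.1 p.2) (Set.Icc (a:ℝ) b ×ˢ Set.Icc (c:ℝ) d))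
    (hfy_cont : ContinuousOn (fun p : ℝ × ℝ => fy p.1 p.2) (Set.Icc (a:ℝ) b ×ˢ Set.Icc (c:ℝ) d))
    (hfxy_cont : ContinuousOn (fun p : ℝ × ℝ => fxy p.1 p.2) (Set.Icc (a:ℝ) b ×ˢ Set.Icc (c:ℝ) d)) :
    ∑ m ∈ Finset.Ioc a b, ∑ n ∈ Finset.Ioc c d, f (m:ℝ) (n:ℝ) =
      (∫ x in (a:ℝ)..b, ∫ y in (c:ℝ)..d, f x y)
      + (∫ x in (a:ℝ)..b, ∫ y in (c:ℝ)..d, fx x y * (x - ⌊x⌋))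
      + (∫ x in (a:ℝ)..b, ∫ y in (c:ℝ)..d, fy x y * (y - ⌊y⌋))
      + ∫ x in (a:ℝ)..b, ∫ y in (c:ℝ)..d, fxy x y * (x - ⌊x⌋) * (y - ⌊y⌋) := by
  have hab' : (a:ℝ) ≤ b := by exact_mod_cast hab.le
  have hcd' : (c:ℝ) ≤ d := by exact_mod_cast hcd.le
  have hn : ∀ n ∈ Finset.Ioc c d, (n:ℝ) ∈ Set.Icc (c:ℝ) d := by
    intro n hn
    rw [Finset.mem_Ioc] at hn
    exact ⟨by exact_mod_cast hn.1.le, by exact_mod_cast hn.2⟩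
  have secY : ∀ F : ℝ → ℝ → ℝ,
      ContinuousOn (fun p : ℝ × ℝ => F p.1 p.2) (Set.Icc (a:ℝ) b ×ˢ Set.Icc (c:ℝ) d) →
      ∀ x ∈ Set.Icc (a:ℝ) b, ContinuousOn (F x) (Set.Icc (c:ℝ) d) := by
    intro F hF x hx
    exact hF.comp (f := fun y : ℝ => (x, y)) (by fun_prop) (fun y hy => ⟨hx, hy⟩)
  have secX : ∀ F : ℝ → ℝ → ℝ,
      ContinuousOn (fun p : ℝ × ℝ => F p.1 p.2) (Set.Icc (a:ℝ) b ×ˢ Set.Icc (c:ℝ) d) →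
      ContinuousOn (fun x => ∑ n ∈ Finset.Ioc c d, F x n) (Set.Icc (a:ℝ) b) := by
    intro F hF
    refine continuousOn_finsetSum _ fun n hn' => ?_
    exact hF.comp (f := fun x : ℝ => (x, (n:ℝ))) (by fun_prop) (fun x hx => ⟨hx, hn n hn'⟩)
  have e1 : ∀ x ∈ Set.Icc (a:ℝ) b, ∑ n ∈ Finset.Ioc c d, f x n =
      (∫ y in (c:ℝ)..d, f x y) + ∫ y in (c:ℝ)..d, fy x y * (y - ⌊y⌋) := fun x hx =>
    aux_one c d hcd.le (f x) (fy x) (fun y hy => hfy x hx y hy) (secY fy hfy_cont x hx)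
  have e2 : ∀ x ∈ Set.Icc (a:ℝ) b, ∑ n ∈ Finset.Ioc c d, fx x n =
      (∫ y in (c:ℝ)..d, fx x y) + ∫ y in (c:ℝ)..d, fxy x y * (y - ⌊y⌋) := fun x hx =>
    aux_one c d hcd.le (fx x) (fxy x) (fun y hy => hfxy x hx y hy) (secY fxy hfxy_cont x hx)
  have c1 := aux_param _ _ _ _ hab' hcd' f hf_cont
  have c2 := aux_param _ _ _ _ hab' hcd' fx hfx_cont
  have c3 : ContinuousOn (fun x => ∫ y in (c:ℝ)..d, fy x y * (y - ⌊y⌋)) (Set.Icc (a:ℝ) b) :=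
    ((secX f hf_cont).sub c1).congr fun x hx => by simp [e1 x hx]
  have c4 : ContinuousOn (fun x => ∫ y in (c:ℝ)..d, fxy x y * (y - ⌊y⌋)) (Set.Icc (a:ℝ) b) :=
    ((secX fx hfx_cont).sub c2).congr fun x hx => by simp [e2 x hx]
  have key := aux_one a b hab.le (fun x => ∑ n ∈ Finset.Ioc c d, f x n)
    (fun x => ∑ n ∈ Finset.Ioc c d, fx x n)
    (fun x hx => HasDerivAt.fun_sum fun n hn' => hfx x hx n (hn n hn')) (secX fx hfx_cont)
  rw [key]
  have i1 : ∫ x in (a:ℝ)..b, ∑ n ∈ Finset.Ioc c d, f x n =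
      (∫ x in (a:ℝ)..b, ∫ y in (c:ℝ)..d, f x y)
      + ∫ x in (a:ℝ)..b, ∫ y in (c:ℝ)..d, fy x y * (y - ⌊y⌋) := by
    rw [← intervalIntegral.integral_add]
    · apply intervalIntegral.integral_congr
      intro x hx
      rw [Set.uIcc_of_le hab'] at hx
      exact e1 x hx
    · apply ContinuousOn.intervalIntegrable; rwa [Set.uIcc_of_le hab']
    · apply ContinuousOn.intervalIntegrable; rwa [Set.uIcc_of_le hab']
  have r1 : ∀ x : ℝ, ∫ y in (c:ℝ)..d, fx x y * (x - ⌊x⌋) =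
      (∫ y in (c:ℝ)..d, fx x y) * (x - ⌊x⌋) := fun x =>
    intervalIntegral.integral_mul_const _ _
  have r2 : ∀ x : ℝ, ∫ y in (c:ℝ)..d, fxy x y * (x - ⌊x⌋) * (y - ⌊y⌋) =
      (∫ y in (c:ℝ)..d, fxy x y * (y - ⌊y⌋)) * (x - ⌊x⌋) := fun x => by
    rw [← intervalIntegral.integral_mul_const]
    congr 1; funext y; ring
  have i2 : ∫ x in (a:ℝ)..b, (∑ n ∈ Finset.Ioc c d, fx x n) * (x - ⌊x⌋) =
      (∫ x in (a:ℝ)..b, ∫ y in (c:ℝ)..d, fx x y * (x - ⌊x⌋))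
      + ∫ x in (a:ℝ)..b, ∫ y in (c:ℝ)..d, fxy x y * (x - ⌊x⌋) * (y - ⌊y⌋) := by
    simp only [r1, r2]
    rw [← intervalIntegral.integral_add]
    · apply intervalIntegral.integral_congr
      intro x hx
      rw [Set.uIcc_of_le hab'] at hx
      simp only [e2 x hx]
      ring
    · exact aux_int _ _ hab' _ c2
    · exact aux_int _ _ hab' _ c4
  rw [i1, i2]
  ring
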